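/- In the Banach space C([0,1], ℝ) of continuous real-valued functions on [0,1] with the supremum norm, the subset consisting of all functions of bounded variation on [0,1] does not contain an infinite-dimensional closed linear subspace; that is, this subset is not spaceable. -/

import Mathlib

open Filter Topology

/-- A set `A` is spaceable if `A ∪ {0}` contains a closed infinite-dimensional subspace. -/
def Spaceable (𝕜 : Type*) {E : Type*} [Semiring 𝕜] [AddCommMonoid E] [Module 𝕜 E]
    [TopologicalSpace E] (A : Set E) : Prop :=
  ∃ F : Submodule 𝕜 E, IsClosed (F : Set E) ∧ ¬ Module.Finite 𝕜 F ∧ (F : Set E) ⊆ A ∪ {0}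

section LinearOrder

variable {α : Type*} [LinearOrder α]

theorem eVariationOn_sub_le {E : Type*} [SeminormedAddCommGroup E] (f g : α → E) (s : Set α) :
    eVariationOn (f - g) s ≤ eVariationOn f s + eVariationOn g s := by
  refine iSup_le fun p => ?_
  calc ∑ i ∈ Finset.range p.1, edist ((f - g) (p.2.1 (i + 1))) ((f - g) (p.2.1 i))
      ≤ ∑ i ∈ Finset.range p.1, (edist (f (p.2.1 (i + 1))) (f (p.2.1 i)) +
          edist (g (p.2.1 (i + 1))) (g (p.2.1 i))) := by
        refine Finset.sum_le_sum fun i _ => ?_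
        simp only [Pi.sub_apply, edist_eq_enorm_sub]
        rw [sub_sub_sub_comm]
        exact enorm_sub_le
    _ ≤ _ := by
        rw [Finset.sum_add_distrib]
        exact add_le_add (eVariationOn.sum_le p.2.2.1 p.2.2.2)
          (eVariationOn.sum_le p.2.2.1 p.2.2.2)

theorem isClosed_setOf_eVariationOn_le [TopologicalSpace α] {E : Type*} [PseudoEMetricSpace E]
    (s : Set α) (M : ENNReal) : IsClosed {f : C(α, E) | eVariationOn f s ≤ M} := by
  simp only [eVariationOn, iSup_le_iff, Set.ofPred_forall]
  refine isClosed_iInter fun p => isClosed_le ?_ continuous_const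
  exact continuous_finsetSum _ fun i _ =>
    (continuous_eval_const _).edist (continuous_eval_const _)

theorem abs_sub_le_toReal_eVariationOn_Iic_sub {f : α → ℝ} (hf : BoundedVariationOn f Set.univ)
    {y z : α} (hyz : y ≤ z) :
    |f z - f y| ≤ (eVariationOn f (Set.Iic z)).toReal - (eVariationOn f (Set.Iic y)).toReal := by
  have h : eVariationOn f (Set.Iic y) + edist (f z) (f y) ≤ eVariationOn f (Set.Iic z) :=
    calc eVariationOn f (Set.Iic y) + edist (f z) (f y)
        ≤ eVariationOn f (Set.Iic y) + eVariationOn f (Set.Icc y z) := by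
          gcongr
          exact eVariationOn.edist_le f ⟨hyz, le_rfl⟩ ⟨le_rfl, hyz⟩
      _ ≤ eVariationOn f (Set.Iic y ∪ Set.Icc y z) :=
          eVariationOn.add_le_union f fun a ha b hb => le_trans ha hb.1
      _ ≤ eVariationOn f (Set.Iic z) := eVariationOn.mono f
          (Set.union_subset (Set.Iic_subset_Iic.2 hyz) fun a ha => ha.2)
  have h' := ENNReal.toReal_mono (hf.mono (Set.subset_univ _)) h
  rw [ENNReal.toReal_add (hf.mono (Set.subset_univ _)) (edist_ne_top _ _), edist_dist,
    ENNReal.toReal_ofReal dist_nonneg, Real.dist_eq] at h'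
  linarith

end LinearOrder

theorem Ultrafilter.exists_tendsto_of_abs_le {ι : Type*} (U : Ultrafilter ι) {u : ι → ℝ} {R : ℝ}
    (hu : ∀ k, |u k| ≤ R) : ∃ l, Tendsto u U (𝓝 l) := by
  obtain ⟨l, -, hl⟩ := (isCompact_Icc (a := -R) (b := R)).ultrafilter_le_nhds (U.map u)
    (le_principal_iff.2 (Filter.mem_map.2 (Filter.univ_mem' fun k => abs_le.1 (hu k))))
  exact ⟨l, hl⟩

theorem Filter.Tendsto.eventually_prod_abs_sub_lt {ι : Type*} {U : Filter ι} {u : ι → ℝ} {l : ℝ}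
    (hu : Tendsto u U (𝓝 l)) {δ : ℝ} (hδ : 0 < δ) :
    ∀ᶠ p in U ×ˢ U, |u p.1 - u p.2| < δ := by
  have h : Tendsto (fun p : ι × ι => |u p.1 - u p.2|) (U ×ˢ U) (𝓝 |l - l|) :=
    ((hu.comp tendsto_fst).sub (hu.comp tendsto_snd)).abs
  exact h.eventually_lt_const (by simpa using hδ)

/-- Along an ultrafilter, functions dominated by the increments of uniformly bounded monotone
functions are eventually uniformly close to each other near all points of a punctured
neighborhood of any given point. -/
theorem eventually_nhdsNE_exists_nhds_eventually_abs_sub_lt {α ι : Type*} [LinearOrder α]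
    [TopologicalSpace α] [OrderTopology α] (U : Ultrafilter ι) {f v : ι → α → ℝ} {R M : ℝ}
    (hf : ∀ k x, |f k x| ≤ R) (hv : ∀ k x, |v k x| ≤ M)
    (hfv : ∀ k y z, y ≤ z → |f k z - f k y| ≤ v k z - v k y) {δ : ℝ} (hδ : 0 < δ) (x : α) :
    ∀ᶠ y in 𝓝[≠] x, ∃ W ∈ 𝓝 y, ∀ᶠ p in (U : Filter ι) ×ˢ (U : Filter ι), ∀ z ∈ W,
      |f p.1 z - f p.2 z| < δ := by
  choose w hw using fun y => U.exists_tendsto_of_abs_le fun k => hv k y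
  have hmono : Monotone w := fun y z hyz => le_of_tendsto_of_tendsto (hw y) (hw z)
    (Eventually.of_forall fun k => by
      have := (abs_nonneg _).trans (hfv k y z hyz)
      linarith)
  have key : ∀ s : Set α, IsOpen s → (∃ l, Tendsto w (𝓝[s] x) (𝓝 l)) →
      ∀ᶠ y in 𝓝[s] x, ∃ W ∈ 𝓝 y, ∀ᶠ p in (U : Filter ι) ×ˢ (U : Filter ι), ∀ z ∈ W,
        |f p.1 z - f p.2 z| < δ := by
    rintro s hs ⟨l, hl⟩
    have h1 : ∀ᶠ y in 𝓝[s] x, |w y - l| < δ / 8 := by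
      simpa [Real.dist_eq] using hl.eventually (Metric.ball_mem_nhds l (by positivity : 0 < δ / 8))
    rw [← eventually_eventually_nhdsWithin] at h1
    filter_upwards [h1, self_mem_nhdsWithin] with y hy hys
    rw [hs.nhdsWithin_eq hys] at hy
    obtain ⟨b, c, hybc, hW, hsub⟩ := exists_Icc_mem_subset_of_mem_nhds hy
    have hbc : b ≤ c := hybc.1.trans hybc.2
    refine ⟨Set.Icc b c, hW, ?_⟩
    have hosc : w c - w b < δ / 4 := by
      have h2 : |w c - l| < δ / 8 := hsub ⟨hbc, le_rfl⟩
      have h3 : |w b - l| < δ / 8 := hsub ⟨le_rfl, hbc⟩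
      rw [abs_lt] at h2 h3
      linarith [h2.2, h3.1]
    have hev : ∀ᶠ k in (U : Filter ι), v k c - v k b < δ / 4 :=
      ((hw c).sub (hw b)).eventually_lt_const hosc
    obtain ⟨φ, hφ⟩ := U.exists_tendsto_of_abs_le fun k => hf k b
    filter_upwards [hφ.eventually_prod_abs_sub_lt (half_pos hδ), hev.prod_mk hev]
      with p hp hp' z hz
    have hclose : ∀ k, v k c - v k b < δ / 4 → |f k z - f k b| < δ / 4 := fun k hk => by
      have h4 := hfv k b z hz.1
      have h5 := (abs_nonneg _).trans (hfv k z c hz.2)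
      linarith
    have h6 := abs_lt.1 (hclose _ hp'.1)
    have h7 := abs_lt.1 (hclose _ hp'.2)
    have h8 := abs_lt.1 hp
    rw [abs_lt]
    constructor <;> linarith [h6.1, h6.2, h7.1, h7.2, h8.1, h8.2]
  rw [← nhdsLT_sup_nhdsGT, eventually_sup]
  exact ⟨key _ isOpen_Iio ⟨_, hmono.tendsto_nhdsLT x⟩, key _ isOpen_Ioi ⟨_, hmono.tendsto_nhdsGT x⟩⟩

/-- A gliding hump argument: functions which are eventually small at each point, and eventually
uniformly small near most points, contain an almost disjointly supported sequence. -/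
theorem exists_seq_almost_disjoint {α : Type*} [TopologicalSpace α] [CompactSpace α]
    {G : Filter C(α, ℝ)} [G.NeBot] {p : C(α, ℝ) → Prop} (hp : ∀ᶠ g in G, p g) {δ : ℝ}
    (hpt : ∀ x, ∀ᶠ g in G, |g x| < δ)
    (hloc : ∀ x, ∀ᶠ y in 𝓝[≠] x, ∃ W ∈ 𝓝 y, ∀ᶠ g in G, ∀ z ∈ W, |g z| < δ) :
    ∃ g : ℕ → C(α, ℝ), (∀ n, p (g n)) ∧
      ∀ m n, m < n → ∀ x, |g m x| < δ ∨ |g n x| < δ := by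
  set S : Set α := {y | ¬ ∃ W ∈ 𝓝 y, ∀ᶠ g in G, ∀ z ∈ W, |g z| < δ} with hS
  have hfin : S.Finite := by
    have h : (Set.univ ∩ S).Finite := by
      refine isCompact_univ.induction_on (p := fun s => (s ∩ S).Finite) (by simp)
        (fun s t hst ht => ht.subset (Set.inter_subset_inter_left _ hst))
        (fun s t hs ht => by rw [Set.union_inter_distrib_right]; exact hs.union ht) fun x _ => ?_
      refine ⟨{y | y ≠ x → y ∉ S}, ?_, (Set.finite_singleton x).subset ?_⟩
      · rw [nhdsWithin_univ]
        have := eventually_nhdsWithin_iff.1 (hloc x)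
        filter_upwards [this] with y hy hyx
        simpa [hS] using hy hyx
      · rintro y ⟨hy, hyS⟩
        by_contra hne
        exact hy hne hyS
    simpa using h
  have hsmall : ∀ᶠ g in G, ∀ x ∈ S, |g x| < δ := (eventually_all_finite hfin).2 fun x _ => hpt x
  have hdisj : ∀ g : C(α, ℝ), (∀ x ∈ S, |g x| < δ) →
      ∀ᶠ g' in G, ∀ x, |g x| < δ ∨ |g' x| < δ := by
    intro g hg
    have hB : IsCompact {x | δ ≤ |g x|} :=
      (isClosed_le continuous_const g.continuous.abs).isCompact
    have h := hB.induction_on (p := fun s => ∀ᶠ g' : C(α, ℝ) in G, ∀ x ∈ s, |g' x| < δ) (by simp)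
      (fun s t hst ht => ht.mono fun g' h x hx => h x (hst hx))
      (fun s t hs ht => by
        filter_upwards [hs, ht] with g' h1 h2 x hx
        exact hx.elim (h1 x) (h2 x))
      (fun x hx => by
        have hxS : x ∉ S := fun h => (hg x h).not_ge hx
        obtain ⟨W, hW, hWG⟩ := not_not.1 hxS
        exact ⟨W, mem_nhdsWithin_of_mem_nhds hW, hWG⟩)
    filter_upwards [h] with g' h x
    exact (lt_or_ge |g x| δ).imp_right fun hx => h x hx
  obtain ⟨g, hg, hgr⟩ := exists_seq_of_forall_finset_exists
    (fun g : C(α, ℝ) => p g ∧ ∀ x ∈ S, |g x| < δ) (fun g g' => ∀ x, |g x| < δ ∨ |g' x| < δ)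
    fun s hs => by
      have h := (eventually_all_finset s).2 fun g hg => hdisj g (hs g hg).2
      exact ((hp.and hsmall).and h).exists
  exact ⟨g, fun n => (hg n).1, hgr⟩

/-- The alternating sum of almost disjointly supported peaks is uniformly bounded but has
large variation. -/
theorem exists_sum_le_eVariationOn {α : Type*} [LinearOrder α] [TopologicalSpace α]
    [CompactSpace α] {n : ℕ} {g : Fin (n + 1) → C(α, ℝ)} {t : Fin (n + 1) → α} (ht : Monotone t)
    {A d δ : ℝ} (hδ : 0 ≤ δ) (hnδ : 2 * ((n + 1) * δ) ≤ d) (hδd : δ ≤ d)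
    (hA : ∀ i, ‖g i‖ ≤ A) (hd : ∀ i, d ≤ |g i (t i)|)
    (hdisj : ∀ i j, i ≠ j → ∀ x, |g i x| < δ ∨ |g j x| < δ) :
    ∃ ε : Fin (n + 1) → ℝ, ‖∑ i, ε i • g i‖ ≤ A + (n + 1) * δ ∧
      ENNReal.ofReal (n * d) ≤ eVariationOn (∑ i, ε i • g i : C(α, ℝ)) Set.univ := by
  have hA0 : 0 ≤ A := (norm_nonneg _).trans (hA 0)
  obtain ⟨ε, hε, hεt⟩ : ∃ ε : Fin (n + 1) → ℝ, (∀ i, |ε i| = 1) ∧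
      ∀ i, ε i * g i (t i) = (-1) ^ (i : ℕ) * |g i (t i)| := by
    refine ⟨fun i => (-1) ^ (i : ℕ) * if 0 ≤ g i (t i) then 1 else -1, fun i => ?_, fun i => ?_⟩
    · dsimp only
      split_ifs <;> simp
    · dsimp only
      split_ifs with h
      · rw [abs_of_nonneg h]; ring
      · rw [abs_of_neg (not_le.1 h)]; ring
  set h : C(α, ℝ) := ∑ i, ε i • g i with hh
  have happ : ∀ x, h x = ∑ i, ε i * g i x := fun x => by simp [hh, ContinuousMap.sum_apply]
  have hrest : ∀ i x, (∀ j, j ≠ i → |g j x| ≤ δ) → |h x - ε i * g i x| ≤ (n + 1) * δ := by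
    intro i x hx
    rw [happ, ← Finset.sum_erase_eq_sub (Finset.mem_univ i)]
    calc |∑ j ∈ Finset.univ.erase i, ε j * g j x|
        ≤ ∑ j ∈ Finset.univ.erase i, |ε j * g j x| := Finset.abs_sum_le_sum_abs _ _
      _ ≤ ∑ j ∈ Finset.univ.erase i, δ := Finset.sum_le_sum fun j hj => by
          rw [abs_mul, hε, one_mul]
          exact hx j (Finset.ne_of_mem_erase hj)
      _ ≤ ∑ j : Fin (n + 1), δ :=
          Finset.sum_le_sum_of_subset_of_nonneg (Finset.erase_subset _ _) fun _ _ _ => hδ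
      _ = (n + 1) * δ := by simp
  refine ⟨ε, ?_, ?_⟩
  · refine (ContinuousMap.norm_le _ (by positivity)).2 fun x => ?_
    obtain ⟨i, hi⟩ : ∃ i, ∀ j, j ≠ i → |g j x| ≤ δ := by
      by_cases hbig : ∃ i, δ ≤ |g i x|
      · obtain ⟨i, hi⟩ := hbig
        exact ⟨i, fun j hj => ((hdisj j i hj x).resolve_right hi.not_gt).le⟩
      · push Not at hbig
        exact ⟨0, fun j _ => (hbig j).le⟩
    have h1 := hrest i x hi
    have h2 : |ε i * g i x| ≤ A := by
      rw [abs_mul, hε, one_mul]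
      exact ((g i).norm_coe_le_norm x).trans (hA i)
    rw [Real.norm_eq_abs]
    have h3 := abs_add_le (h x - ε i * g i x) (ε i * g i x)
    rw [sub_add_cancel] at h3
    linarith
  · have hpeak : ∀ i, |h (t i) - |g i (t i)| * (-1) ^ (i : ℕ)| ≤ (n + 1) * δ := fun i => by
      rw [mul_comm |g i (t i)|, ← hεt]
      exact hrest i (t i) fun j hj =>
        ((hdisj j i hj (t i)).resolve_right (hδd.trans (hd i)).not_gt).le
    set u : ℕ → α := fun k => t (Fin.ofNat (n + 1) (min k n)) with hu
    have hval : ∀ k, ((Fin.ofNat (n + 1) (min k n) : Fin (n + 1)) : ℕ) = min k n := fun k => by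
      simp only [Fin.val_ofNat]
      exact Nat.mod_eq_of_lt (by omega)
    have humono : Monotone u := fun k l hkl => ht (by
      rw [Fin.le_def, hval, hval]
      exact min_le_min_right n hkl)
    calc ENNReal.ofReal (n * d) = ∑ k ∈ Finset.range n, ENNReal.ofReal d := by
          rw [Finset.sum_const, Finset.card_range, nsmul_eq_mul,
            ENNReal.ofReal_mul (by positivity), ENNReal.ofReal_natCast]
      _ ≤ ∑ k ∈ Finset.range n, edist (h (u (k + 1))) (h (u k)) := by
          refine Finset.sum_le_sum fun k hk => ?_
          have hk := Finset.mem_range.1 hk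
          rw [edist_dist, Real.dist_eq]
          refine ENNReal.ofReal_le_ofReal ?_
          have h1 := hpeak (Fin.ofNat (n + 1) (min (k + 1) n))
          have h2 := hpeak (Fin.ofNat (n + 1) (min k n))
          have h3 := hd (Fin.ofNat (n + 1) (min (k + 1) n))
          have h4 := hd (Fin.ofNat (n + 1) (min k n))
          rw [hval, min_eq_left (by omega), pow_succ] at h1
          rw [hval k, min_eq_left (a := k) (by omega)] at h2
          rw [min_eq_left (by omega)] at h3
          rw [min_eq_left (by omega)] at h4
          simp only [hu]
          rw [min_eq_left (by omega : k + 1 ≤ n), min_eq_left hk.le]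
          rw [abs_le] at h1 h2
          rcases neg_one_pow_eq_or ℝ k with hs | hs <;> rw [hs] at h1 h2
          · rw [abs_sub_comm]
            exact le_trans (by linarith [h1.1, h1.2, h2.1, h2.2]) (le_abs_self _)
          · exact le_trans (by linarith [h1.1, h1.2, h2.1, h2.2]) (le_abs_self _)
      _ ≤ eVariationOn h Set.univ := eVariationOn.sum_le humono fun _ => Set.mem_univ _

/-- In a closed subspace of functions of bounded variation, the variation is bounded on a ball. -/
theorem Submodule.exists_eVariationOn_le_of_isClosed {α : Type*} [LinearOrder α]
    [TopologicalSpace α] [CompactSpace α] {F : Submodule ℝ C(α, ℝ)}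
    (hF : IsClosed (F : Set C(α, ℝ))) (hBV : ∀ f ∈ F, BoundedVariationOn f Set.univ) :
    ∃ r > 0, ∃ M : ℕ, ∀ f ∈ F, ‖f‖ ≤ r → eVariationOn f Set.univ ≤ M := by
  have : CompleteSpace F := hF.completeSpace_coe
  have : TopologicalSpace.IsCompletelyPseudoMetrizableSpace F :=
    PseudoMetricSpace.toIsCompletelPseudoMetrizableSpace
  have : BaireSpace F := .of_completelyPseudoMetrizable
  obtain ⟨N, f₀, hf₀⟩ := nonempty_interior_of_iUnion_of_closed
    (f := fun N : ℕ => {f : F | eVariationOn (f : C(α, ℝ)) Set.univ ≤ N})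
    (fun N => (isClosed_setOf_eVariationOn_le Set.univ (N : ENNReal)).preimage
      continuous_subtype_val)
    (Set.eq_univ_of_forall fun f => Set.mem_iUnion.2 <| by
      obtain ⟨N, hN⟩ := ENNReal.exists_nat_gt (hBV f f.2)
      exact ⟨N, hN.le⟩)
  obtain ⟨r, hr, hball⟩ := Metric.isOpen_iff.1 isOpen_interior f₀ hf₀
  refine ⟨r / 2, half_pos hr, 2 * N, fun f hf hfr => ?_⟩
  have hmem : ∀ g ∈ interior {f : F | eVariationOn (f : C(α, ℝ)) Set.univ ≤ N},
      eVariationOn (g : C(α, ℝ)) Set.univ ≤ N := fun g hg => by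
    simpa using interior_subset hg
  have h0 := hmem f₀ hf₀
  have h1 : eVariationOn ((f₀ + ⟨f, hf⟩ : F) : C(α, ℝ)) Set.univ ≤ N := by
    refine hmem _ (hball ?_)
    rw [Metric.mem_ball, dist_eq_norm, add_sub_cancel_left]
    exact lt_of_le_of_lt hfr (half_lt_self hr)
  have h2 : (f : α → ℝ) = ((f₀ + ⟨f, hf⟩ : F) : C(α, ℝ)) - (f₀ : C(α, ℝ)) := by
    ext x
    simp
  rw [h2]
  refine (eVariationOn_sub_le _ _ _).trans ((add_le_add h1 h0).trans ?_)
  push_cast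
  rw [two_mul]

/-- A closed subspace of functions of bounded variation on a compact linear order is finite
dimensional. -/
theorem Submodule.finite_of_isClosed_of_boundedVariationOn {α : Type*} [LinearOrder α]
    [TopologicalSpace α] [OrderTopology α] [CompactSpace α] {F : Submodule ℝ C(α, ℝ)}
    (hF : IsClosed (F : Set C(α, ℝ))) (hBV : ∀ f ∈ F, BoundedVariationOn f Set.univ) :
    Module.Finite ℝ F := by
  by_contra hinf
  obtain ⟨r, hr, M, hM⟩ := Submodule.exists_eVariationOn_le_of_isClosed hF hBV
  obtain ⟨R, e, hR1, heR, hsep⟩ := exists_seq_norm_le_one_le_norm_sub (𝕜 := ℝ) (E := F) hinf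
  have hR : 0 < R := by linarith
  set d : ℝ := r / (4 * R) with hd_def
  have hd : 0 < d := by positivity
  set f : ℕ → C(α, ℝ) := fun k => d • (e k : C(α, ℝ)) with hf_def
  have hfF : ∀ k, f k ∈ F := fun k => F.smul_mem _ (e k).2
  have hfr : ∀ k, ‖f k‖ ≤ r / 4 := fun k => by
    rw [hf_def, norm_smul, Real.norm_of_nonneg hd.le]
    calc d * ‖(e k : C(α, ℝ))‖ ≤ d * R := by gcongr; exact heR k
      _ = r / 4 := by rw [hd_def]; field_simp
  have hfsep : ∀ k l, k ≠ l → d ≤ ‖f k - f l‖ := fun k l hkl => by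
    rw [hf_def, ← smul_sub, norm_smul, Real.norm_of_nonneg hd.le]
    exact le_mul_of_one_le_right hd.le (hsep hkl)
  have hfabs : ∀ k x, |f k x| ≤ r / 4 := fun k x => ((f k).norm_coe_le_norm x).trans (hfr k)
  set v : ℕ → α → ℝ := fun k x => (eVariationOn (f k) (Set.Iic x)).toReal
  have hvM : ∀ k x, |v k x| ≤ M := fun k x => by
    rw [abs_of_nonneg ENNReal.toReal_nonneg]
    exact ENNReal.toReal_le_of_le_ofReal (Nat.cast_nonneg _) (by
      rw [ENNReal.ofReal_natCast]
      exact (eVariationOn.mono _ (Set.subset_univ _)).trans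
        (hM _ (hfF k) ((hfr k).trans (by linarith))))
  have hfv : ∀ k y z, y ≤ z → |f k z - f k y| ≤ v k z - v k y := fun k y z hyz =>
    abs_sub_le_toReal_eVariationOn_Iic_sub (hBV _ (hfF k)) hyz
  let U : Ultrafilter ℕ := hyperfilter ℕ
  let G : Filter C(α, ℝ) := ((U : Filter ℕ).curry (U : Filter ℕ)).map fun p => f p.1 - f p.2
  have : G.NeBot := by
    refine NeBot.map ⟨fun h => ?_⟩ _
    have h' := (eventually_curry_iff (p := fun _ => False)).1 (empty_mem_iff_bot.2 h)
    exact U.neBot.ne (by simpa using h')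
  have hG : ∀ᶠ g in G, g ∈ F ∧ ‖g‖ ≤ r / 2 ∧ d ≤ ‖g‖ := by
    rw [eventually_map, eventually_curry_iff]
    refine Eventually.of_forall fun k => ?_
    have hne : ∀ᶠ l in (U : Filter ℕ), l ≠ k :=
      hyperfilter_le_cofinite (Set.finite_singleton k).compl_mem_cofinite
    filter_upwards [hne] with l hl
    refine ⟨F.sub_mem (hfF k) (hfF l), ?_, hfsep k l hl.symm⟩
    have := norm_sub_le (f k) (f l)
    linarith [hfr k, hfr l]
  obtain ⟨n, hn⟩ := exists_nat_gt (M / d)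
  rw [div_lt_iff₀ hd] at hn
  set δ : ℝ := min d r / (4 * (n + 1)) with hδ_def
  have hδ : 0 < δ := by positivity
  have hnδ : (n + 1) * δ = min d r / 4 := by rw [hδ_def]; field_simp
  have hminr := min_le_right d r
  have hmind := min_le_left d r
  obtain ⟨g, hg, hdisj⟩ := exists_seq_almost_disjoint hG (δ := δ)
    (fun x => by
      obtain ⟨l, hl⟩ := U.exists_tendsto_of_abs_le fun k => hfabs k x
      exact (hl.eventually_prod_abs_sub_lt hδ).filter_mono curry_le_prod)
    (fun x => by
      filter_upwards [eventually_nhdsNE_exists_nhds_eventually_abs_sub_lt U hfabs hvM hfv hδ x]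
        with y ⟨W, hW, h⟩
      exact ⟨W, hW, h.filter_mono curry_le_prod⟩)
  have hpeak : ∀ i, ∃ t, d ≤ |g i t| := fun i => by
    by_contra! h
    have : Nonempty α := by
      by_contra hα
      rw [not_nonempty_iff] at hα
      have : g i = 0 := by ext x; exact hα.elim x
      have h1 := (hg i).2.2
      rw [this, norm_zero] at h1
      linarith
    exact ((ContinuousMap.norm_lt_iff _ hd).2 h).not_ge (hg i).2.2
  choose t ht using hpeak
  let σ := Tuple.sort fun i : Fin (n + 1) => t i
  obtain ⟨ε, hnorm, hvar⟩ := exists_sum_le_eVariationOn (n := n) (g := fun i => g (σ i))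
    (t := fun i => t (σ i)) (A := r / 2) (d := d) (δ := δ)
    (Tuple.monotone_sort fun i : Fin (n + 1) => t i)
    hδ.le (by linarith) (by nlinarith [(Nat.cast_nonneg n : (0 : ℝ) ≤ n)])
    (fun i => (hg _).2.1) (fun i => ht _) (fun i j hij x => by
      have hne : ((σ i : Fin (n + 1)) : ℕ) ≠ σ j := fun h => hij (σ.injective (Fin.ext h))
      rcases hne.lt_or_gt with h | h
      · exact hdisj _ _ h x
      · exact (hdisj _ _ h x).symm)
  have hle := hvar.trans (hM _ (F.sum_mem fun i _ => F.smul_mem _ (hg _).1) (by linarith))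
  rw [← ENNReal.ofReal_natCast, ENNReal.ofReal_le_ofReal_iff (Nat.cast_nonneg _)] at hle
  linarith

/-- **Levine–Milman.** In `C([0,1], ℝ)` with the sup norm, the set of functions of bounded
variation contains no infinite-dimensional closed subspace, i.e. it is not spaceable. -/
theorem boundedVariation_not_spaceable :
    ¬ Spaceable ℝ {f : C(Set.Icc (0 : ℝ) 1, ℝ) | BoundedVariationOn (⇑f) Set.univ} := by
  rintro ⟨F, hF, hinf, hsub⟩
  refine hinf (Submodule.finite_of_isClosed_of_boundedVariationOn hF fun f hf => ?_)
  rcases hsub hf with h | h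
  · exact h
  · rw [Set.mem_singleton_iff.1 h]
    have h0 : eVariationOn (0 : Set.Icc (0 : ℝ) 1 → ℝ) Set.univ = 0 :=
      eVariationOn.constant_on (by rintro _ ⟨x, -, rfl⟩ _ ⟨y, -, rfl⟩; rfl)
    simp [BoundedVariationOn, h0]
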